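/- Let r be a power of p and m = (m_j)_{j≥0} an integer sequence with m_0 = 1 and m_j ≥ 2 for all j ≥ 1. Then the Laurent series ξ(r,m) is a T-number. -/

import Mathlib

open Polynomial Filter Set
open scoped Classical

noncomputable section

namespace OotoT

variable (Fq : Type) [Field Fq]

/-- We model the field `F_q((T⁻¹))` of Laurent series in `T⁻¹` as `LaurentSeries Fq`,
whose canonical variable `u` plays the role of `T⁻¹`.  Thus `T` itself is `u⁻¹`. -/
def Tel : LaurentSeries Fq := (HahnSeries.single (1 : ℤ) (1 : Fq))⁻¹

/-- The canonical ring embedding `F_q[T] → F_q((T⁻¹))`, sending `T ↦ u⁻¹`. -/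
def ringHomT : Polynomial Fq →+* LaurentSeries Fq :=
  Polynomial.eval₂RingHom (HahnSeries.C : Fq →+* LaurentSeries Fq) (Tel Fq)

/-- The absolute value on `F_q((T⁻¹))`: `|0| = 0` and `|ξ| = q^{-N}` where
`ξ = Σ_{n ≥ N} a_n T^{-n}` with `a_N ≠ 0`; in our model `N` is the order of `ξ`
as a Hahn series in `u = T⁻¹`. -/
def absL (q : ℕ) (ξ : LaurentSeries Fq) : ℝ :=
  if ξ = 0 then 0 else (q : ℝ) ^ (-ξ.order)

/-- Evaluation of a polynomial `P(X) ∈ (F_q[T])[X]` at `ξ ∈ F_q((T⁻¹))`. -/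
def evalP (ξ : LaurentSeries Fq) (P : Polynomial (Polynomial Fq)) : LaurentSeries Fq :=
  Polynomial.eval₂ (ringHomT Fq) ξ P

/-- The height of `P(X) ∈ (F_q[T])[X]`: the maximum of the absolute values of its
coefficients.  A nonzero `c ∈ F_q[T]` has `|c| = q^{deg c}`, so for `P ≠ 0` the height
is `q` raised to the maximal degree of a (nonzero) coefficient of `P`. -/
def heightP (q : ℕ) (P : Polynomial (Polynomial Fq)) : ℝ :=
  if P = 0 then 0 else (q : ℝ) ^ (P.support.sup fun i => (P.coeff i).natDegree)

/-- `w_n(ξ)`: the supremum (in the extended reals) of the real numbers `w` such that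
`0 < |P(ξ)| ≤ H(P)^{-w}` for infinitely many `P(X) ∈ (F_q[T])[X]` of degree at most `n`. -/
def wn (q : ℕ) (n : ℕ) (ξ : LaurentSeries Fq) : EReal :=
  sSup ((fun w : ℝ => (w : EReal)) ''
    {w : ℝ | {P : Polynomial (Polynomial Fq) | P.natDegree ≤ n ∧
      0 < absL Fq q (evalP Fq ξ P) ∧
      absL Fq q (evalP Fq ξ P) ≤ heightP Fq q P ^ (-w)}.Infinite})

/-- `w(ξ) = limsup_{n→∞} w_n(ξ)/n`. -/
def wB (q : ℕ) (ξ : LaurentSeries Fq) : EReal :=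
  Filter.limsup (fun n : ℕ => wn Fq q n ξ / (n : EReal)) Filter.atTop

/-- `ξ` is an `A`-number if `w(ξ) = 0`. -/
def IsANumber (q : ℕ) (ξ : LaurentSeries Fq) : Prop := wB Fq q ξ = 0

/-- `ξ` is an `S`-number if `0 < w(ξ) < +∞`. -/
def IsSNumber (q : ℕ) (ξ : LaurentSeries Fq) : Prop := 0 < wB Fq q ξ ∧ wB Fq q ξ < ⊤

/-- `ξ` is a `T`-number if `w(ξ) = +∞` and `w_n(ξ) < +∞` for all `n ≥ 1`. -/
def IsTNumber (q : ℕ) (ξ : LaurentSeries Fq) : Prop :=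
  wB Fq q ξ = ⊤ ∧ ∀ n : ℕ, 1 ≤ n → wn Fq q n ξ < ⊤

/-- `ξ` is a `U`-number if `w(ξ) = +∞` and `w_n(ξ) = +∞` for some `n ≥ 1`. -/
def IsUNumber (q : ℕ) (ξ : LaurentSeries Fq) : Prop :=
  wB Fq q ξ = ⊤ ∧ ∃ n : ℕ, 1 ≤ n ∧ wn Fq q n ξ = ⊤

/-- The type `t(ξ) = limsup_{n→∞} (log w_n(ξ))/(log n)` of a `T`-number (as an
extended real; for a `T`-number each `w_n(ξ)` is a finite real, recovered by `toReal`). -/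
def typeT (q : ℕ) (ξ : LaurentSeries Fq) : EReal :=
  Filter.limsup
    (fun n : ℕ => ((Real.log (wn Fq q n ξ).toReal / Real.log n : ℝ) : EReal)) Filter.atTop

/-! ### The algebraic closure side -/

/-- The algebraic closure of `F_q((T⁻¹))`. -/
abbrev AC := AlgebraicClosure (LaurentSeries Fq)

/-- The canonical embedding of `F_q((T⁻¹))` into its algebraic closure. -/
def iota : LaurentSeries Fq →+* AC Fq := algebraMap _ _

/-- The embedding `F_q[T] → AC`. -/
def ringHomTC : Polynomial Fq →+* AC Fq := (iota Fq).comp (ringHomT Fq)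

/-- Evaluation of `P(X) ∈ (F_q[T])[X]` at an element of the algebraic closure. -/
def evalPC (α : AC Fq) (P : Polynomial (Polynomial Fq)) : AC Fq :=
  Polynomial.eval₂ (ringHomTC Fq) α P

/-- `P ∈ (F_q[T])[X]` is *the* minimal polynomial of `α`: it is non-constant, irreducible,
primitive, its leading coefficient is monic (in `T`), and `P(α) = 0`.  For `α` algebraic
over `F_q(T)` such a polynomial exists and is unique. -/
def IsMinPolyOf (α : AC Fq) (P : Polynomial (Polynomial Fq)) : Prop :=
  0 < P.natDegree ∧ Irreducible P ∧ P.IsPrimitive ∧ P.leadingCoeff.Monic ∧ evalPC Fq α P = 0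

/-- `α` is algebraic over `F_q(T)`. -/
def IsAlgT (α : AC Fq) : Prop := ∃ P, IsMinPolyOf Fq α P

/-- The degree of an algebraic `α`: the degree of its minimal polynomial. -/
def degT (α : AC Fq) : ℕ := if h : IsAlgT Fq α then h.choose.natDegree else 0

/-- The height of an algebraic `α`: the height of its minimal polynomial. -/
def heightT (q : ℕ) (α : AC Fq) : ℝ := if h : IsAlgT Fq α then heightP Fq q h.choose else 0

/-- The unique extension of the absolute value to the algebraic closure of `F_q((T⁻¹))`,
given by the standard formula `|x| = |N_{K(x)/K}(x)|^{1/[K(x):K]}`, i.e.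
`|x| = |c₀|^{1/d}` where `c₀` is the constant coefficient and `d` the degree of the
minimal polynomial of `x` over `K = F_q((T⁻¹))`. -/
def absC (q : ℕ) (x : AC Fq) : ℝ :=
  absL Fq q ((minpoly (LaurentSeries Fq) x).coeff 0) ^
    (((minpoly (LaurentSeries Fq) x).natDegree : ℝ)⁻¹)

/-- `w_n^*(ξ)`: the supremum (in the extended reals) of the real numbers `w` such that
`0 < |ξ - α| ≤ H(α)^{-w-1}` for infinitely many `α` algebraic over `F_q(T)` of degree
at most `n`. -/
def wnStar (q : ℕ) (n : ℕ) (ξ : LaurentSeries Fq) : EReal :=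
  sSup ((fun w : ℝ => (w : EReal)) ''
    {w : ℝ | {α : AC Fq | IsAlgT Fq α ∧ degT Fq α ≤ n ∧
      0 < absC Fq q (iota Fq ξ - α) ∧
      absC Fq q (iota Fq ξ - α) ≤ heightT Fq q α ^ (-w - 1)}.Infinite})

/-- `w^*(ξ) = limsup_{n→∞} w_n^*(ξ)/n`. -/
def wBStar (q : ℕ) (ξ : LaurentSeries Fq) : EReal :=
  Filter.limsup (fun n : ℕ => wnStar Fq q n ξ / (n : EReal)) Filter.atTop

/-- `ξ` is an `A*`-number if `w^*(ξ) = 0`. -/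
def IsAStarNumber (q : ℕ) (ξ : LaurentSeries Fq) : Prop := wBStar Fq q ξ = 0

/-- `ξ` is a `T*`-number if `w^*(ξ) = +∞` and `w_n^*(ξ) < +∞` for all `n ≥ 1`. -/
def IsTStarNumber (q : ℕ) (ξ : LaurentSeries Fq) : Prop :=
  wBStar Fq q ξ = ⊤ ∧ ∀ n : ℕ, 1 ≤ n → wnStar Fq q n ξ < ⊤

/-- The `*`-type `t^*(ξ) = limsup_{n→∞} (log w_n^*(ξ))/(log n)` of a `T*`-number. -/
def typeTStar (q : ℕ) (ξ : LaurentSeries Fq) : EReal :=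
  Filter.limsup
    (fun n : ℕ => ((Real.log (wnStar Fq q n ξ).toReal / Real.log n : ℝ) : EReal)) Filter.atTop

/-! ### The Laurent series `ξ(r, m)` -/

/-- `r_j = r^{m_0 m_1 ⋯ m_j}`. -/
def rr (r : ℕ) (m : ℕ → ℕ) (j : ℕ) : ℕ := r ^ (∏ i ∈ Finset.range (j + 1), m i)

/-- `α_j(r, m) = Σ_{n=1}^∞ T^{-r_j^n}`, i.e. the power series in `u = T⁻¹` whose
`k`-th coefficient is `1` exactly when `k = r_j^n` for some `n ≥ 1`. -/
def alphaJ (r : ℕ) (m : ℕ → ℕ) (j : ℕ) : LaurentSeries Fq :=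
  HahnSeries.ofPowerSeries ℤ Fq (PowerSeries.mk fun k =>
    if ∃ n : ℕ, 1 ≤ n ∧ k = rr r m j ^ n then 1 else 0)

/-- `ξ_a(r, m) = Σ_{j=0}^∞ a_j α_j(r, m)`, described coefficientwise: the coefficient of
`T^{-k}` is the (finite) sum over `j` of `a_j` times the coefficient of `T^{-k}` in
`α_j(r, m)`. -/
def xiA (r : ℕ) (m : ℕ → ℕ) (a : ℕ → ℕ) : LaurentSeries Fq :=
  HahnSeries.ofPowerSeries ℤ Fq (PowerSeries.mk fun k =>
    ∑ᶠ j : ℕ, (a j : Fq) * (if ∃ n : ℕ, 1 ≤ n ∧ k = rr r m j ^ n then 1 else 0))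

/-- `ξ(r, m) = Σ_{j=0}^∞ α_j(r, m)`. -/
def xi (r : ℕ) (m : ℕ → ℕ) : LaurentSeries Fq := xiA Fq r m fun _ => 1

/-! ### Algebraicity and algebraic dependence over `F_q(T)` for Laurent series -/

/-- `ξ ∈ F_q((T⁻¹))` is algebraic over `F_q(T)`. -/
def IsAlgLS (ξ : LaurentSeries Fq) : Prop :=
  ∃ P : Polynomial (Polynomial Fq), P ≠ 0 ∧ evalP Fq ξ P = 0

/-- Evaluation of a two-variable polynomial `F(X, Y) ∈ (F_q[T])[X, Y]` (coded as an
iterated polynomial ring, `T` innermost, then `X`, then `Y`) at `(ξ, η)`. -/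
def evalXY (ξ η : LaurentSeries Fq) (F : Polynomial (Polynomial (Polynomial Fq))) :
    LaurentSeries Fq :=
  Polynomial.eval₂ (Polynomial.eval₂RingHom (ringHomT Fq) ξ) η F

/-- `ξ` and `η` are algebraically dependent over `F_q(T)`. -/
def AlgDep (ξ η : LaurentSeries Fq) : Prop :=
  ∃ F : Polynomial (Polynomial (Polynomial Fq)), F ≠ 0 ∧ evalXY Fq ξ η F = 0

/-- `deg_X` of `F(X, Y) ∈ (F_q[T])[X, Y]` in our encoding. -/
def degX (F : Polynomial (Polynomial (Polynomial Fq))) : ℕ :=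
  F.support.sup fun i => (F.coeff i).natDegree

/-- `F(X, Y) ∈ (F_q[T])[X, Y]` is primitive (in `X` and `Y`): no non-unit of `F_q[T]`
divides all of its coefficients. -/
def IsPrimitiveXY (F : Polynomial (Polynomial (Polynomial Fq))) : Prop :=
  ∀ c : Polynomial Fq, (∀ i j : ℕ, c ∣ ((F.coeff i).coeff j)) → IsUnit c

end OotoT

open OotoT

namespace OotoT

/-! ### Size bounds in `F_q((T⁻¹))` -/

section Size

variable {F : Type} [Field F]

/-- `DegLE k x` says that `|x| ≤ q ^ k`. -/
def DegLE (k : ℤ) (x : LaurentSeries F) : Prop := ∀ i : ℤ, i < -k → x.coeff i = 0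

theorem degLE_iff {k : ℤ} {x : LaurentSeries F} :
    DegLE k x ↔ ((-k : ℤ) : WithTop ℤ) ≤ x.orderTop := by
  rw [HahnSeries.le_orderTop_iff_forall]
  simp only [DegLE, WithTop.coe_lt_coe]

theorem DegLE.mono {k l : ℤ} {x : LaurentSeries F} (h : DegLE k x) (hkl : k ≤ l) : DegLE l x :=
  fun i hi => h i (by omega)

theorem degLE_zero (k : ℤ) : DegLE k (0 : LaurentSeries F) := fun _ _ => rfl

theorem DegLE.add {k : ℤ} {x y : LaurentSeries F} (hx : DegLE k x) (hy : DegLE k y) :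
    DegLE k (x + y) := fun i hi => by
  rw [HahnSeries.coeff_add, hx i hi, hy i hi, add_zero]

theorem DegLE.sub {k : ℤ} {x y : LaurentSeries F} (hx : DegLE k x) (hy : DegLE k y) :
    DegLE k (x - y) := fun i hi => by
  rw [HahnSeries.coeff_sub, hx i hi, hy i hi, sub_zero]

theorem DegLE.mul {k l : ℤ} {x y : LaurentSeries F} (hx : DegLE k x) (hy : DegLE l y) :
    DegLE (k + l) (x * y) := by
  rw [degLE_iff] at *
  refine le_trans ?_ HahnSeries.orderTop_add_le_mul
  rw [neg_add, WithTop.coe_add]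
  exact add_le_add hx hy

theorem DegLE.sum {ι : Type*} {k : ℤ} {s : Finset ι} {f : ι → LaurentSeries F}
    (h : ∀ i ∈ s, DegLE k (f i)) : DegLE k (∑ i ∈ s, f i) :=
  Finset.sum_induction f (DegLE k) (fun _ _ => DegLE.add) (degLE_zero k) h

theorem degLE_one : DegLE 0 (1 : LaurentSeries F) := by
  rw [degLE_iff]
  simp

theorem DegLE.pow {x : LaurentSeries F} (hx : DegLE 0 x) (n : ℕ) : DegLE 0 (x ^ n) := by
  induction n with
  | zero => simpa using degLE_one
  | succ n ih => simpa [pow_succ] using ih.mul hx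

theorem exists_degLE (x : LaurentSeries F) : ∃ k : ℕ, DegLE k x := by
  by_cases hx : x = 0
  · exact ⟨0, hx ▸ degLE_zero _⟩
  · refine ⟨(-x.order).toNat, ?_⟩
    rw [degLE_iff, ← HahnSeries.order_eq_orderTop_of_ne_zero hx, WithTop.coe_le_coe]
    omega

theorem exists_degLE_of_finite {ι : Type*} [Finite ι] (f : ι → LaurentSeries F) :
    ∃ k : ℕ, ∀ i, DegLE k (f i) := by
  choose g hg using fun i => exists_degLE (f i)
  obtain ⟨k, hk⟩ := Set.finite_range g |>.bddAbove
  exact ⟨k, fun i => (hg i).mono (by exact_mod_cast hk ⟨i, rfl⟩)⟩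

theorem absL_pos_iff {q : ℕ} (hq : 0 < q) {x : LaurentSeries F} : 0 < absL F q x ↔ x ≠ 0 := by
  unfold absL
  split_ifs with h
  · simp [h]
  · simp only [ne_eq, h, not_false_eq_true, iff_true]
    positivity

theorem DegLE.absL_le {q : ℕ} (hq : 1 < q) {x : LaurentSeries F} {k : ℤ} (h : DegLE k x) :
    absL F q x ≤ (q : ℝ) ^ k := by
  unfold absL
  split_ifs with h0
  · positivity
  · rw [degLE_iff, ← HahnSeries.order_eq_orderTop_of_ne_zero h0, WithTop.coe_le_coe] at h
    exact zpow_le_zpow_right₀ (by exact_mod_cast hq.le) (by omega)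

theorem degLE_of_absL_le {q : ℕ} (hq : 1 < q) {x : LaurentSeries F} {k : ℤ}
    (h : absL F q x ≤ (q : ℝ) ^ k) : DegLE k x := by
  unfold absL at h
  split_ifs at h with h0
  · exact h0 ▸ degLE_zero k
  · rw [degLE_iff, ← HahnSeries.order_eq_orderTop_of_ne_zero h0, WithTop.coe_le_coe]
    have := (zpow_le_zpow_iff_right₀ (by exact_mod_cast hq : (1 : ℝ) < q)).1 h
    omega

/-! ### The embedding of `F_q[T]` -/

theorem ringHomT_X_pow (n : ℕ) :
    ringHomT F (X ^ n) = HahnSeries.single (-(n : ℤ)) (1 : F) := by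
  have hT : Tel F = HahnSeries.single (-1 : ℤ) (1 : F) := by
    rw [Tel, inv_eq_of_mul_eq_one_right]
    rw [HahnSeries.single_mul_single]
    simp
  rw [map_pow, ringHomT, coe_eval₂RingHom, eval₂_X, hT, HahnSeries.single_pow]
  simp

theorem ringHomT_C (a : F) : ringHomT F (C a) = HahnSeries.single (0 : ℤ) a := by
  simp [ringHomT]

theorem coeff_ringHomT (a : F[X]) (n : ℕ) : (ringHomT F a).coeff (-(n : ℤ)) = a.coeff n := by
  induction a using Polynomial.induction_on' with
  | add p q hp hq => simp [hp, hq]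
  | monomial k a =>
    rw [← C_mul_X_pow_eq_monomial, map_mul, ringHomT_X_pow, ringHomT_C,
      HahnSeries.single_mul_single, coeff_C_mul, coeff_X_pow]
    simp [HahnSeries.coeff_single]

theorem ringHomT_injective : Function.Injective (ringHomT F) := fun a b h => by
  ext n
  rw [← coeff_ringHomT, h, coeff_ringHomT]

theorem not_degLE_ringHomT {a : F[X]} (ha : a ≠ 0) : ¬ DegLE (-1) (ringHomT F a) := fun h =>
  leadingCoeff_ne_zero.2 ha (by
    rw [leadingCoeff, ← coeff_ringHomT]
    exact h _ (by omega))

theorem degLE_ringHomT {a : F[X]} {n : ℕ} (ha : a.natDegree ≤ n) : DegLE n (ringHomT F a) := by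
  rw [as_sum_range_C_mul_X_pow a, map_sum]
  refine DegLE.sum fun i hi => ?_
  rw [map_mul, ringHomT_X_pow, ringHomT_C, HahnSeries.single_mul_single]
  intro j hj
  rw [Finset.mem_range] at hi
  exact HahnSeries.coeff_single_of_ne (by omega)

end Size

/-! ### A Liouville inequality over `F_q[T]` -/

/-- Over an integrally closed domain `A`, the powers of an integral element `α` of a field have a
multiplication table `M`, and `g(α)` divides `det g(M)` with the cofactor given by the adjugate. -/
theorem exists_matrix_det_eq_mul {A L : Type*} [CommRing A] [IsDomain A] [IsIntegrallyClosed A]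
    [Field L] (φ : A →+* L) (hφ : Function.Injective φ) {α : L} {Q : A[X]} (hQ : Q.Monic)
    (hα : Q.eval₂ φ α = 0) :
    ∃ D ≤ Q.natDegree, ∃ (M : Matrix (Fin D) (Fin D) A) (o : Fin D → A) (b : Fin D → L),
      ∀ g : A[X], g.eval₂ φ α ≠ 0 → (aeval M g).det ≠ 0 ∧
        φ (aeval M g).det = g.eval₂ φ α * ∑ i, φ (((aeval M g).adjugate.mulVec o) i) * b i := by
  let _ : Algebra A L := φ.toAlgebra
  have : FaithfulSMul A L := (faithfulSMul_iff_algebraMap_injective A L).2 hφ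
  have hint : IsIntegral A α := ⟨Q, hQ, hα⟩
  let pb := Algebra.adjoin.powerBasis' hint
  have hgen : ((pb.gen : Algebra.adjoin A {α}) : L) = α := by
    simp only [pb, Algebra.adjoin.powerBasis'_gen]
  have : Module.Free A (Algebra.adjoin A {α}) := Module.Free.of_basis pb.basis
  have : Module.Finite A (Algebra.adjoin A {α}) := Module.Finite.of_basis pb.basis
  refine ⟨pb.dim, natDegree_le_natDegree (minpoly.min A α hQ hα),
    Algebra.leftMulMatrix pb.basis pb.gen, pb.basis.repr 1, fun i => (pb.basis i : L), ?_⟩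
  intro g hg
  set x : Algebra.adjoin A {α} := aeval pb.gen g with hx
  have hxg : (x : L) = g.eval₂ φ α := by
    rw [hx, ← Subalgebra.coe_val, ← Polynomial.aeval_algHom_apply, Subalgebra.coe_val, hgen]
    rfl
  have hM : aeval (Algebra.leftMulMatrix pb.basis pb.gen) g = Algebra.leftMulMatrix pb.basis x := by
    rw [hx, Polynomial.aeval_algHom_apply]
  rw [hM]
  set M := Algebra.leftMulMatrix pb.basis x
  have hx0 : x ≠ 0 := fun h => hg (by rw [← hxg, h]; rfl)
  refine ⟨?_, ?_⟩
  · rw [← Algebra.norm_eq_matrix_det]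
    exact Algebra.norm_ne_zero_iff.2 hx0
  · let y : Algebra.adjoin A {α} := ∑ i, (M.adjugate.mulVec (pb.basis.repr 1)) i • pb.basis i
    have hy : (pb.basis.repr y : Fin pb.dim → A) = M.adjugate.mulVec (pb.basis.repr 1) := by
      rw [pb.basis.repr_sum_self]
    have hxy : x * y = algebraMap A _ M.det := by
      apply pb.basis.repr.injective
      apply DFunLike.coe_injective
      rw [← Algebra.leftMulMatrix_mulVec_repr, hy, Matrix.mulVec_mulVec, Matrix.mul_adjugate,
        Algebra.algebraMap_eq_smul_one, map_smul, Matrix.smul_mulVec, Matrix.one_mulVec]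
      rfl
    have := congrArg (Subtype.val) hxy
    rw [Subalgebra.coe_mul, hxg] at this
    have h2 : (y : L) = ∑ i, φ ((M.adjugate.mulVec (pb.basis.repr 1)) i) * (pb.basis i : L) := by
      simp only [y, AddSubmonoidClass.coe_finsetSum, Algebra.smul_def]
      rfl
    rw [← h2, this]
    rfl

theorem natDegree_det_le {A : Type*} [CommRing A] {D K : ℕ} (M : Matrix (Fin D) (Fin D) A[X])
    (h : ∀ i j, (M i j).natDegree ≤ K) : M.det.natDegree ≤ D * K := by
  rw [Matrix.det_apply]
  refine natDegree_sum_le_of_forall_le _ _ fun σ _ => ?_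
  refine (natDegree_smul_le _ _).trans ((natDegree_prod_le _ _).trans ?_)
  refine (Finset.sum_le_card_nsmul _ _ K fun i _ => h _ _).trans ?_
  simp

theorem natDegree_adjugate_le {A : Type*} [CommRing A] {D K : ℕ}
    (M : Matrix (Fin D) (Fin D) A[X]) (h : ∀ i j, (M i j).natDegree ≤ K) (i j : Fin D) :
    (M.adjugate i j).natDegree ≤ D * K := by
  rw [Matrix.adjugate_apply]
  refine natDegree_det_le _ fun a b => ?_
  rw [Matrix.updateRow_apply]
  split_ifs
  · rw [Pi.single_apply]
    split_ifs <;> simp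
  · exact h a b

theorem liouville_ringHomT {F : Type} [Field F] {α : LaurentSeries F} {Q : F[X][X]}
    (hQ : Q.Monic) (hα : Q.eval₂ (ringHomT F) α = 0) (n : ℕ) :
    ∃ c : ℕ, ∀ (H : ℕ) (g : F[X][X]), g.natDegree ≤ n → (∀ l, (g.coeff l).natDegree ≤ H) →
      g.eval₂ (ringHomT F) α ≠ 0 →
        ¬ DegLE (-((Q.natDegree * H + c : ℕ) : ℤ)) (g.eval₂ (ringHomT F) α) := by
  obtain ⟨D, hD, M, o, b, hM⟩ := exists_matrix_det_eq_mul (ringHomT F) ringHomT_injective hQ hα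
  obtain ⟨cb, hcb⟩ := exists_degLE_of_finite b
  obtain ⟨co, hco⟩ : ∃ co : ℕ, ∀ i, (o i).natDegree ≤ co := by
    obtain ⟨k, hk⟩ := (Set.finite_range fun i => (o i).natDegree).bddAbove
    exact ⟨k, fun i => hk ⟨i, rfl⟩⟩
  obtain ⟨cM, hcM⟩ : ∃ cM : ℕ, ∀ (l : Fin (n + 1)) (i j : Fin D),
      ((M ^ (l : ℕ)) i j).natDegree ≤ cM := by
    obtain ⟨k, hk⟩ := (Set.finite_range fun t : Fin (n + 1) × Fin D × Fin D =>
      ((M ^ (t.1 : ℕ)) t.2.1 t.2.2).natDegree).bddAbove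
    exact ⟨k, fun l i j => hk ⟨(l, i, j), rfl⟩⟩
  refine ⟨Q.natDegree * cM + co + cb + 1, fun H g hgn hgH hg0 hdeg => ?_⟩
  obtain ⟨hdet, heq⟩ := hM g hg0
  apply not_degLE_ringHomT hdet
  have hentry : ∀ i j, ((aeval M g) i j).natDegree ≤ H + cM := by
    intro i j
    rw [aeval_eq_sum_range' (Nat.lt_succ_of_le hgn), Matrix.sum_apply]
    refine natDegree_sum_le_of_forall_le _ _ fun l hl => ?_
    rw [Matrix.smul_apply, smul_eq_mul]
    exact natDegree_mul_le.trans
      (add_le_add (hgH l) (hcM ⟨l, Finset.mem_range.1 hl⟩ i j))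
  have hcof : ∀ i, (((aeval M g).adjugate.mulVec o) i).natDegree ≤ D * (H + cM) + co := by
    intro i
    rw [Matrix.mulVec, dotProduct]
    refine natDegree_sum_le_of_forall_le _ _ fun j _ => ?_
    exact natDegree_mul_le.trans (add_le_add (natDegree_adjugate_le _ hentry i j) (hco j))
  rw [heq]
  refine (hdeg.mul (DegLE.sum (k := ((D * (H + cM) + co : ℕ) : ℤ) + cb)
    fun i _ => (degLE_ringHomT (hcof i)).mul (hcb i))).mono ?_
  have : D * (H + cM) ≤ Q.natDegree * (H + cM) := Nat.mul_le_mul_right _ hD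
  push_cast
  have h' : (D : ℤ) * (H + cM) ≤ Q.natDegree * (H + cM) := by exact_mod_cast this
  linarith

/-! ### Lacunary series `∑ c(e) T^{-r^e}` -/

section Lacunary

variable (F : Type) [Field F]

/-- The power series `∑_{e ≥ 1} c(e) u^{r^e}`. -/
def lacPS (r : ℕ) (c : ℕ → ℤ) : PowerSeries F :=
  PowerSeries.mk fun k => if 1 ≤ Nat.log r k ∧ k = r ^ Nat.log r k then (c (Nat.log r k) : F) else 0

/-- The Laurent series `∑_{e ≥ 1} c(e) T^{-r^e}`. -/
def lac (r : ℕ) (c : ℕ → ℤ) : LaurentSeries F := HahnSeries.ofPowerSeries ℤ F (lacPS F r c)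

variable {F} {r : ℕ}

theorem coeff_lacPS_pow (hr : 1 < r) (c : ℕ → ℤ) {e : ℕ} (he : 1 ≤ e) :
    PowerSeries.coeff (r ^ e) (lacPS F r c) = c e := by
  simp [lacPS, Nat.log_pow hr, he]

theorem coeff_lacPS_of_forall_ne (c : ℕ → ℤ) {k : ℕ} (hk : ∀ e, 1 ≤ e → k ≠ r ^ e) :
    PowerSeries.coeff k (lacPS F r c) = 0 := by
  rw [lacPS, PowerSeries.coeff_mk, if_neg]
  exact fun h => hk _ h.1 h.2

theorem lacPS_ext (hr : 1 < r) {c : ℕ → ℤ} {f : PowerSeries F}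
    (h1 : ∀ e, 1 ≤ e → PowerSeries.coeff (r ^ e) f = c e)
    (h2 : ∀ k, (∀ e, 1 ≤ e → k ≠ r ^ e) → PowerSeries.coeff k f = 0) : f = lacPS F r c := by
  ext k
  by_cases hk : ∃ e, 1 ≤ e ∧ k = r ^ e
  · obtain ⟨e, he, rfl⟩ := hk
    rw [h1 e he, coeff_lacPS_pow hr c he]
  · push Not at hk
    rw [h2 k hk, coeff_lacPS_of_forall_ne c hk]

theorem lac_congr (hr : 1 < r) {c d : ℕ → ℤ} (h : ∀ e, 1 ≤ e → (c e : F) = d e) :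
    lac F r c = lac F r d :=
  congrArg (HahnSeries.ofPowerSeries ℤ F) (lacPS_ext hr
    (fun e he => by rw [coeff_lacPS_pow hr c he, h e he])
    fun _ hk => coeff_lacPS_of_forall_ne c hk)

theorem lac_add (hr : 1 < r) (c d : ℕ → ℤ) :
    lac F r (fun e => c e + d e) = lac F r c + lac F r d := by
  rw [lac, lac, lac, ← map_add]
  refine congrArg _ (lacPS_ext hr (fun e he => ?_) fun k hk => ?_).symm
  · rw [map_add, coeff_lacPS_pow hr c he, coeff_lacPS_pow hr d he, Int.cast_add]
  · rw [map_add, coeff_lacPS_of_forall_ne c hk, coeff_lacPS_of_forall_ne d hk, add_zero]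

theorem lac_sub (hr : 1 < r) (c d : ℕ → ℤ) :
    lac F r (fun e => c e - d e) = lac F r c - lac F r d := by
  rw [eq_sub_iff_add_eq, ← lac_add hr]
  simp

/-- Raising to the power `r ^ s` shifts the coefficient sequence by `s`. -/
theorem lac_pow {p : ℕ} [hp : Fact p.Prime] [CharP F p] {a : ℕ} (ha : 0 < a) (hra : r = p ^ a)
    (c : ℕ → ℤ) (s : ℕ) :
    lac F r c ^ r ^ s = lac F r (fun e => if s < e then c (e - s) else 0) := by
  have hr : 1 < r := hra ▸ Nat.one_lt_pow ha.ne' hp.out.one_lt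
  have hrs : r ^ s = p ^ (a * s) := by rw [hra, pow_mul]
  rw [lac, lac, ← map_pow]
  have hcoef : ∀ k, PowerSeries.coeff k (lacPS F r c ^ r ^ s) =
      iterateFrobenius F p (a * s)
        (if r ^ s ∣ k then PowerSeries.coeff (k / r ^ s) (lacPS F r c) else 0) := by
    intro k
    have h0 : p ^ (a * s) ≠ 0 := pow_ne_zero _ hp.out.ne_zero
    have h := MvPowerSeries.map_iterateFrobenius_expand p hp.out.ne_zero (lacPS F r c) (a * s)
    have h' : PowerSeries.map (iterateFrobenius F p (a * s))
        (PowerSeries.expand (p ^ (a * s)) h0 (lacPS F r c)) = lacPS F r c ^ p ^ (a * s) := h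
    rw [hrs, ← h', PowerSeries.coeff_map, PowerSeries.coeff_expand]
  refine congrArg _ (lacPS_ext hr (fun e he => ?_) fun k hk => ?_)
  · rw [hcoef]
    split_ifs with h1 h2 h2
    · rw [Nat.pow_div h2.le (by omega), coeff_lacPS_pow hr c (by omega), map_intCast]
    · have hes : e = s := le_antisymm (not_lt.1 h2) ((Nat.pow_dvd_pow_iff_le_right hr).1 h1)
      subst hes
      rw [Nat.div_self (by positivity), coeff_lacPS_of_forall_ne, map_zero, Int.cast_zero]
      intro e he h
      exact (Nat.one_lt_pow (by omega) hr).ne h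
    · exact absurd (pow_dvd_pow r h2.le) h1
    · simp
  · rw [hcoef]
    split_ifs with h1
    · rw [coeff_lacPS_of_forall_ne, map_zero]
      intro e he h
      refine hk (e + s) (by omega) ?_
      rw [pow_add, ← h, Nat.div_mul_cancel h1]
    · simp

theorem degLE_ofPowerSeries {f : PowerSeries F} {n : ℕ}
    (h : ∀ k < n, PowerSeries.coeff k f = 0) :
    DegLE (-(n : ℤ)) (HahnSeries.ofPowerSeries ℤ F f) := by
  intro i hi
  rw [PowerSeries.coeff_coe]
  split_ifs with h0
  · rfl
  · exact h _ (by omega)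

theorem degLE_lac (hr : 1 < r) {c : ℕ → ℤ} {E : ℕ} (h : ∀ e, 1 ≤ e → e < E → (c e : F) = 0) :
    DegLE (-((r ^ E : ℕ) : ℤ)) (lac F r c) := by
  refine degLE_ofPowerSeries fun k hk => ?_
  by_cases hke : ∃ e, 1 ≤ e ∧ k = r ^ e
  · obtain ⟨e, he, rfl⟩ := hke
    rw [coeff_lacPS_pow hr c he, h e he ((Nat.pow_lt_pow_iff_right hr).1 hk)]
  · push Not at hke
    exact coeff_lacPS_of_forall_ne c hke

theorem degLE_zero_lac (c : ℕ → ℤ) : DegLE 0 (lac F r c) := by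
  simpa [lac] using degLE_ofPowerSeries (f := lacPS F r c) (n := 0) (by simp)

theorem coeff_lac_pow (hr : 1 < r) (c : ℕ → ℤ) {e : ℕ} (he : 1 ≤ e) :
    (lac F r c).coeff ((r ^ e : ℕ) : ℤ) = c e := by
  rw [lac, LaurentSeries.coeff_coe_powerSeries, coeff_lacPS_pow hr c he]

variable (F) in
/-- The polynomial `T^{r^E} ∑_{1 ≤ e ≤ E} c(e) T^{-r^e}`. -/
def lacNum (r : ℕ) (c : ℕ → ℤ) (E : ℕ) : F[X] :=
  ∑ e ∈ Finset.Icc 1 E, C (c e : F) * X ^ (r ^ E - r ^ e)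

theorem natDegree_lacNum_le (c : ℕ → ℤ) (E : ℕ) : (lacNum F r c E).natDegree ≤ r ^ E :=
  natDegree_sum_le_of_forall_le _ _ fun _ _ =>
    (natDegree_C_mul_X_pow_le _ _).trans (Nat.sub_le _ _)

theorem ringHomT_lacNum (hr : 1 < r) (c : ℕ → ℤ) (E : ℕ) :
    ringHomT F (lacNum F r c E) =
      ringHomT F (X ^ r ^ E) * lac F r (fun e => if e ≤ E then c e else 0) := by
  have hlac : lac F r (fun e => if e ≤ E then c e else 0) =
      ∑ e ∈ Finset.Icc 1 E, HahnSeries.single ((r ^ e : ℕ) : ℤ) (c e : F) := by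
    have h : ∀ e : ℕ, HahnSeries.single ((r ^ e : ℕ) : ℤ) (c e : F) =
        HahnSeries.ofPowerSeries ℤ F (PowerSeries.C (c e : F) * PowerSeries.X ^ r ^ e) := by
      intro e
      rw [map_mul, HahnSeries.ofPowerSeries_C, HahnSeries.ofPowerSeries_X_pow,
        HahnSeries.C_apply, HahnSeries.single_mul_single]
      simp
    rw [Finset.sum_congr rfl fun e _ => h e, ← map_sum, lac]
    refine congrArg _ (lacPS_ext hr (fun e he => ?_) fun k hk => ?_).symm
    · simp only [map_sum, PowerSeries.coeff_C_mul, PowerSeries.coeff_X_pow, mul_ite, mul_one,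
        mul_zero, (Nat.pow_right_injective hr).eq_iff, Finset.sum_ite_eq, Finset.mem_Icc, he,
        true_and]
      split_ifs <;> simp
    · rw [map_sum]
      refine Finset.sum_eq_zero fun e he => ?_
      rw [PowerSeries.coeff_C_mul, PowerSeries.coeff_X_pow,
        if_neg (hk e (Finset.mem_Icc.1 he).1), mul_zero]
  rw [hlac, lacNum, map_sum, Finset.mul_sum]
  refine Finset.sum_congr rfl fun e he => ?_
  have hle : r ^ e ≤ r ^ E := Nat.pow_le_pow_right (by omega) (Finset.mem_Icc.1 he).2
  rw [map_mul, ringHomT_X_pow, ringHomT_X_pow, ringHomT_C, HahnSeries.single_mul_single,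
    HahnSeries.single_mul_single, mul_one, one_mul, Nat.cast_sub hle]
  congr 2
  ring

end Lacunary

/-! ### The coefficients of `ξ(r, m)` -/

section Count

/-- `M_j = m_0 m_1 ⋯ m_j`. -/
def prodM (m : ℕ → ℕ) (j : ℕ) : ℕ := ∏ i ∈ Finset.range (j + 1), m i

/-- The number of `j < J` with `M_j ∣ e`. -/
def cnt (m : ℕ → ℕ) (J e : ℕ) : ℤ := ∑ j ∈ Finset.range J, if prodM m j ∣ e then 1 else 0

/-- For `e ≥ 1`, the number of all `j` with `M_j ∣ e`, since these satisfy `j < M_j ≤ e`. -/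
def cntAll (m : ℕ → ℕ) (e : ℕ) : ℤ := cnt m e e

variable {m : ℕ → ℕ}

theorem prodM_dvd {i j : ℕ} (hij : i ≤ j) : prodM m i ∣ prodM m j :=
  Finset.prod_dvd_prod_of_subset _ _ _ (Finset.range_mono (by omega))

theorem prodM_succ (j : ℕ) : prodM m (j + 1) = prodM m j * m (j + 1) :=
  Finset.prod_range_succ _ _

theorem lt_prodM (hm0 : m 0 = 1) (hm : ∀ j, 1 ≤ j → 2 ≤ m j) (j : ℕ) : j < prodM m j := by
  induction j with
  | zero => simp [prodM, hm0]
  | succ j ih =>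
    rw [prodM_succ]
    nlinarith [hm (j + 1) (by omega)]

theorem two_mul_prodM_le (hm : ∀ j, 1 ≤ j → 2 ≤ m j) (j : ℕ) :
    2 * prodM m j ≤ prodM m (j + 1) := by
  rw [prodM_succ, mul_comm]
  exact Nat.mul_le_mul_left _ (hm _ (by omega))

theorem not_prodM_succ_dvd (hm0 : m 0 = 1) (hm : ∀ j, 1 ≤ j → 2 ≤ m j) (j : ℕ) :
    ¬ prodM m (j + 1) ∣ prodM m j := by
  have h1 := lt_prodM hm0 hm j
  have h2 := two_mul_prodM_le hm j
  exact Nat.not_dvd_of_pos_of_lt (by omega) (by omega)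

theorem cnt_eq_cntAll (hm0 : m 0 = 1) (hm : ∀ j, 1 ≤ j → 2 ≤ m j) {J e : ℕ} (he : 1 ≤ e)
    (hJ : ∀ j, J ≤ j → ¬ prodM m j ∣ e) : cnt m J e = cntAll m e := by
  have key : ∀ J', J ≤ J' → cnt m J e = cnt m J' e := fun J' hJ' => by
    refine Finset.sum_subset (Finset.range_mono hJ') fun j _ hj => if_neg (hJ j ?_)
    simpa using hj
  have key' : ∀ J', e ≤ J' → cnt m e e = cnt m J' e := fun J' hJ' => by
    refine Finset.sum_subset (Finset.range_mono hJ') fun j _ hj => if_neg fun h => ?_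
    have h1 := Nat.le_of_dvd he h
    have h2 := lt_prodM hm0 hm j
    simp only [Finset.mem_range, not_lt] at hj
    omega
  rw [cntAll, key (max J e) (le_max_left _ _), key' (max J e) (le_max_right _ _)]

theorem cntAll_eq_cnt (hm0 : m 0 = 1) (hm : ∀ j, 1 ≤ j → 2 ≤ m j) {k e : ℕ} (he : 1 ≤ e)
    (hk : ¬ prodM m (k + 1) ∣ e) : cntAll m e = cnt m (k + 1) e :=
  (cnt_eq_cntAll hm0 hm he fun _ hj h => hk ((prodM_dvd hj).trans h)).symm

theorem cnt_add_prodM (k e : ℕ) : cnt m (k + 1) (e + prodM m k) = cnt m (k + 1) e := by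
  refine Finset.sum_congr rfl fun j hj => ?_
  rw [Finset.mem_range] at hj
  simp only [Nat.dvd_add_left (prodM_dvd (m := m) (Nat.lt_succ_iff.1 hj))]

theorem cnt_of_dvd {k e : ℕ} (h : prodM m k ∣ e) : cnt m (k + 1) e = k + 1 := by
  rw [cnt, Finset.sum_congr rfl fun j hj => if_pos ((prodM_dvd
    (Nat.lt_succ_iff.1 (Finset.mem_range.1 hj))).trans h)]
  simp

theorem cntAll_of_dvd (hm0 : m 0 = 1) (hm : ∀ j, 1 ≤ j → 2 ≤ m j) {k e : ℕ} (he : 1 ≤ e)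
    (h : prodM m k ∣ e) (hk : ¬ prodM m (k + 1) ∣ e) : cntAll m e = k + 1 := by
  rw [cntAll_eq_cnt hm0 hm he hk, cnt_of_dvd h]

theorem xi_eq_lac {F : Type} [Field F] {r : ℕ} (hr : 1 < r) (hm0 : m 0 = 1)
    (hm : ∀ j, 1 ≤ j → 2 ≤ m j) : xi F r m = lac F r (cntAll m) := by
  have hrr : ∀ j n, rr r m j ^ n = r ^ (prodM m j * n) := fun j n => by
    rw [rr, ← pow_mul]
    rfl
  have hpos : ∀ j, 0 < prodM m j := fun j => (Nat.zero_le j).trans_lt (lt_prodM hm0 hm j)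
  refine congrArg _ (lacPS_ext hr (fun e he => ?_) fun k hk => ?_)
  · have hiff : ∀ j, (∃ n, 1 ≤ n ∧ r ^ e = rr r m j ^ n) ↔ prodM m j ∣ e := by
      intro j
      simp only [hrr, (Nat.pow_right_injective hr).eq_iff]
      refine ⟨fun ⟨n, _, h⟩ => ⟨n, h⟩, fun ⟨n, h⟩ => ⟨n, ?_, h⟩⟩
      rcases n with _ | n
      · simp only [mul_zero] at h
        omega
      · omega
    rw [PowerSeries.coeff_mk]
    simp only [hiff, Nat.cast_one, one_mul, cntAll, cnt]
    rw [finsum_eq_sum_of_support_subset _ (s := Finset.range e)]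
    · push_cast
      rfl
    · intro j hj
      have hj' : prodM m j ∣ e := by
        by_contra h
        simp [h] at hj
      have h1 := Nat.le_of_dvd he hj'
      have h2 := lt_prodM hm0 hm j
      simp only [Finset.coe_range, Set.mem_Iio]
      omega
  · rw [PowerSeries.coeff_mk]
    refine finsum_eq_zero_of_forall_eq_zero fun j => ?_
    rw [if_neg, mul_zero]
    rintro ⟨n, hn, rfl⟩
    exact hk _ (Nat.mul_pos (hpos j) hn) (hrr j n)

end Count

/-! ### Lower bounds for `w_n(ξ)` -/

section Lower

theorem heightP_le {F : Type} [Field F] {q : ℕ} (hq : 1 < q) {P : F[X][X]} {H : ℕ}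
    (h : ∀ l, (P.coeff l).natDegree ≤ H) : heightP F q P ≤ (q : ℝ) ^ H := by
  unfold heightP
  split_ifs
  · positivity
  · exact pow_le_pow_right₀ (by exact_mod_cast hq.le) (Finset.sup_le fun l _ => h l)

theorem heightP_pos {F : Type} [Field F] {q : ℕ} (hq : 1 < q) {P : F[X][X]} (hP : P ≠ 0) :
    0 < heightP F q P := by
  rw [heightP, if_neg hP]
  positivity

/-- The coefficient sequence of `ξ ^ r_k - ξ`. -/
def artinSchreierCoeff (m : ℕ → ℕ) (k e : ℕ) : ℤ :=
  (if prodM m k < e then cntAll m (e - prodM m k) else 0) - cntAll m e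

/-- The integers divisible by `M_{k+p}` and not by `M_{k+p+1}`; around them, the coefficients
of `ξ` are `M_k`-periodic modulo `p` on an interval of length about `2 M_{k+1}`. -/
def center (m : ℕ → ℕ) (p k s : ℕ) : ℕ := prodM m (k + p) * (1 + m (k + p + 1) * s)

variable {m : ℕ → ℕ} {p : ℕ}

theorem prodM_dvd_center {k s j : ℕ} (hj : j ≤ k + p) : prodM m j ∣ center m p k s :=
  (prodM_dvd hj).trans (Dvd.intro _ rfl)

theorem cntAll_center (hm0 : m 0 = 1) (hm : ∀ j, 1 ≤ j → 2 ≤ m j) (k s : ℕ) :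
    cntAll m (center m p k s) = k + p + 1 := by
  have hpos := lt_prodM hm0 hm (k + p)
  have h := cntAll_of_dvd hm0 hm (k := k + p) (e := center m p k s)
    (Nat.mul_pos (by omega) (by omega)) (prodM_dvd_center le_rfl) (by
      rw [prodM_succ, center, Nat.mul_dvd_mul_iff_left (by omega),
        Nat.dvd_add_left (Dvd.intro _ rfl), Nat.dvd_one]
      have := hm (k + p + 1) (by omega)
      omega)
  rw [h]
  push_cast
  ring

theorem cast_cntAll_near_center {F : Type} [Field F] [CharP F p] (hp : 1 < p) (hm0 : m 0 = 1)
    (hm : ∀ j, 1 ≤ j → 2 ≤ m j) {k s e : ℕ} (he : 1 ≤ e)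
    (h1 : center m p k s < e + prodM m (k + 1)) (h2 : e < center m p k s + prodM m (k + 1)) :
    (cntAll m e : F) = cnt m (k + 1) e := by
  by_cases hd : prodM m (k + 1) ∣ e
  · have hec : e = center m p k s := by
      obtain ⟨a, rfl⟩ := hd
      obtain ⟨b, hb⟩ := prodM_dvd_center (m := m) (p := p) (s := s) (show k + 1 ≤ k + p by omega)
      rw [hb] at h1 h2 ⊢
      have h1' : b < a + 1 := lt_of_mul_lt_mul_left (a := prodM m (k + 1)) (by linarith) (by omega)
      have h2' : a < b + 1 := lt_of_mul_lt_mul_left (a := prodM m (k + 1)) (by linarith) (by omega)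
      rw [show a = b by omega]
    rw [cnt_of_dvd ((prodM_dvd (by omega)).trans hd), hec, cntAll_center hm0 hm]
    push_cast
    rw [CharP.cast_eq_zero F p, add_zero]
  · rw [cntAll_eq_cnt hm0 hm he hd]

theorem artinSchreierCoeff_eq_zero {F : Type} [Field F] [CharP F p] (hp : 1 < p) (hm0 : m 0 = 1)
    (hm : ∀ j, 1 ≤ j → 2 ≤ m j) {k s e : ℕ}
    (h1 : center m p k s + prodM m k < e + prodM m (k + 1))
    (h2 : e < center m p k s + prodM m (k + 1)) (hc : prodM m (k + 1) ≤ center m p k s) :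
    (artinSchreierCoeff m k e : F) = 0 := by
  have hlt : prodM m k < e := by omega
  rw [artinSchreierCoeff, if_pos hlt, Int.cast_sub,
    cast_cntAll_near_center hp hm0 hm (k := k) (s := s) (e := e) (by omega) (by omega) h2,
    cast_cntAll_near_center hp hm0 hm (k := k) (s := s) (by omega) (by omega) (by omega),
    ← cnt_add_prodM k (e - prodM m k), Nat.sub_add_cancel hlt.le, sub_self]

theorem artinSchreierCoeff_center_add (hp : 1 < p) (hm0 : m 0 = 1)
    (hm : ∀ j, 1 ≤ j → 2 ≤ m j) (k s : ℕ) :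
    artinSchreierCoeff m k (center m p k s + prodM m (k + 1)) = -1 := by
  have hpos := lt_prodM hm0 hm k
  have h2 := two_mul_prodM_le hm k
  have hdk : prodM m k ∣ prodM m (k + 1) := prodM_dvd (by omega)
  rw [artinSchreierCoeff, if_pos (by omega), Nat.add_sub_assoc (by omega),
    cntAll_of_dvd hm0 hm (k := k) (by omega)
      (dvd_add (prodM_dvd_center (by omega)) (Nat.dvd_sub hdk dvd_rfl)) ?_,
    cntAll_of_dvd hm0 hm (k := k + 1) (by omega)
      (dvd_add (prodM_dvd_center (by omega)) dvd_rfl) ?_]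
  · push_cast
    ring
  · rw [Nat.dvd_add_right (prodM_dvd_center (by omega))]
    exact not_prodM_succ_dvd hm0 hm _
  · rw [Nat.dvd_add_right (prodM_dvd_center (by omega))]
    exact Nat.not_dvd_of_pos_of_lt (by omega) (by omega)

/-- `T^{r^E} (X^{r^M} - X - a)` where `a` is the truncation of `∑ d(e) T^{-r^e}` at `e = E`. -/
def approxPoly (F : Type) [Field F] (r M E : ℕ) (d : ℕ → ℤ) : F[X][X] :=
  C (X ^ r ^ E) * (X ^ r ^ M - X) - C (lacNum F r d E)

variable {F : Type} [Field F] {r : ℕ}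

theorem evalP_approxPoly (hr : 1 < r) (M E : ℕ) (d : ℕ → ℤ) {x : LaurentSeries F}
    (hx : x ^ r ^ M - x = lac F r d) :
    evalP F x (approxPoly F r M E d) =
      ringHomT F (X ^ r ^ E) * lac F r (fun e => if e ≤ E then 0 else d e) := by
  have hsub : lac F r (fun e => if e ≤ E then 0 else d e) =
      lac F r d - lac F r (fun e => if e ≤ E then d e else 0) := by
    rw [← lac_sub hr]
    refine lac_congr hr fun e _ => ?_
    split_ifs <;> simp
  rw [evalP, approxPoly, eval₂_sub, eval₂_mul, eval₂_C, eval₂_C, eval₂_sub, eval₂_X_pow, eval₂_X,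
    ringHomT_lacNum hr, hx, hsub, mul_sub]

theorem coeff_approxPoly (hr : 1 < r) {M : ℕ} (hM : 1 ≤ M) (E : ℕ) (d : ℕ → ℤ) :
    (approxPoly F r M E d).coeff (r ^ M) = X ^ r ^ E := by
  have h1 : 1 < r ^ M := Nat.one_lt_pow (by omega) hr
  rw [approxPoly, coeff_sub, coeff_C_mul, coeff_sub, coeff_X_pow_self, coeff_X,
    if_neg h1.ne, coeff_C, if_neg (by omega)]
  simp

theorem natDegree_coeff_approxPoly_le (M E : ℕ) (d : ℕ → ℤ) (l : ℕ) :
    ((approxPoly F r M E d).coeff l).natDegree ≤ r ^ E := by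
  rw [approxPoly, coeff_sub, coeff_C_mul]
  refine (natDegree_sub_le _ _).trans (max_le ?_ ?_)
  · refine natDegree_mul_le.trans ?_
    rw [natDegree_X_pow, coeff_sub, coeff_X_pow, coeff_X]
    split_ifs <;> simp
  · rw [coeff_C]
    split_ifs
    · exact natDegree_lacNum_le d E
    · simp

theorem natDegree_approxPoly_le (hr : 1 < r) (M E : ℕ) (d : ℕ → ℤ) :
    (approxPoly F r M E d).natDegree ≤ r ^ M := by
  have h1 : 1 ≤ r ^ M := Nat.one_le_pow _ _ (by omega)
  unfold approxPoly
  compute_degree!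

theorem sq_le_wn_xi [hpF : Fact p.Prime] [CharP F p] {q : ℕ} (hq : 1 < q) {a : ℕ} (ha : 0 < a)
    (hra : r = p ^ a) (hm0 : m 0 = 1) (hm : ∀ j, 1 ≤ j → 2 ≤ m j) (k : ℕ) :
    ((((r ^ prodM m k : ℕ) : ℝ) ^ 2 : ℝ) : EReal) ≤ wn F q (r ^ prodM m k) (xi F r m) := by
  have hp := hpF.out.one_lt
  have hr : 1 < r := hra ▸ Nat.one_lt_pow ha.ne' hp
  have hMk := lt_prodM hm0 hm k
  have hMk2 := two_mul_prodM_le hm k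
  have hcpos : ∀ s, prodM m (k + 1) ≤ center m p k s := fun s =>
    Nat.le_of_dvd (Nat.mul_pos ((Nat.zero_le _).trans_lt (lt_prodM hm0 hm _)) (by omega))
      (prodM_dvd_center (by omega))
  set R := r ^ prodM m k with hR
  have hR2 : 2 ≤ R := hR ▸ Nat.one_lt_pow (by omega) hr
  set d := artinSchreierCoeff m k with hd
  have hxi : xi F r m ^ R - xi F r m = lac F r d := by
    rw [xi_eq_lac hr hm0 hm, hR, lac_pow ha hra, ← lac_sub hr]
    rfl
  let E : ℕ → ℕ := fun s => center m p k s - prodM m (k + 1) + prodM m k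
  have hEinj : Function.Injective E := by
    have : StrictMono (center m p k) := fun s t hst =>
      Nat.mul_lt_mul_of_pos_left (Nat.add_lt_add_left (Nat.mul_lt_mul_of_pos_left hst
        (by have := hm (k + p + 1) (by omega); omega)) _)
        ((Nat.zero_le _).trans_lt (lt_prodM hm0 hm _))
    intro s t hst
    refine this.injective ?_
    have := hcpos s
    have := hcpos t
    simp only [E] at hst
    omega
  refine le_sSup ⟨(R : ℝ) ^ 2, ?_, rfl⟩
  refine Set.infinite_of_injective_forall_mem
    (f := fun s => approxPoly F r (prodM m k) (E s) d) (fun s t hst => ?_) fun s => ?_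
  · have h := congrArg (fun P => (coeff P R).natDegree) hst
    simp only [hR, coeff_approxPoly hr (show 1 ≤ prodM m k by omega), natDegree_X_pow] at h
    exact hEinj (Nat.pow_right_injective hr h)
  · have heval := evalP_approxPoly hr (prodM m k) (E s) d hxi
    have hP0 : approxPoly F r (prodM m k) (E s) d ≠ 0 := fun h => by
      have := coeff_approxPoly (F := F) hr (show 1 ≤ prodM m k by omega) (E s) d
      rw [h, coeff_zero] at this
      exact pow_ne_zero _ X_ne_zero this.symm
    have hEs : E s = center m p k s - prodM m (k + 1) + prodM m k := rfl
    have hcs := hcpos s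
    refine ⟨natDegree_approxPoly_le hr _ _ _, ?_, ?_⟩
    · rw [absL_pos_iff (by omega), heval]
      refine mul_ne_zero ((map_ne_zero_iff _ ringHomT_injective).2 (pow_ne_zero _ X_ne_zero)) ?_
      intro h
      have := coeff_lac_pow (F := F) hr (fun e => if e ≤ E s then 0 else d e)
        (e := center m p k s + prodM m (k + 1)) (by omega)
      rw [h, if_neg (by omega), hd, artinSchreierCoeff_center_add hp hm0 hm] at this
      simp at this
    · have hdeg : DegLE (-((r ^ E s * R ^ 2 : ℕ) : ℤ))
          (evalP F (xi F r m) (approxPoly F r (prodM m k) (E s) d)) := by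
        rw [heval]
        refine ((degLE_ringHomT (natDegree_X_pow _).le).mul (degLE_lac hr
          (E := center m p k s + prodM m (k + 1)) fun e he1 he2 => ?_)).mono ?_
        · split_ifs with h
          · simp
          · exact artinSchreierCoeff_eq_zero hp hm0 hm (s := s) (by omega) he2 hcs
        · have h3 : r ^ E s * R ^ 3 ≤ r ^ (center m p k s + prodM m (k + 1)) := by
            rw [hR, ← pow_mul, ← pow_add]
            exact Nat.pow_le_pow_right (by omega) (by omega)
          have h4 : R ^ 2 + 1 ≤ R ^ 3 := by nlinarith [sq_nonneg R]
          have h5 := (Nat.mul_le_mul_left (r ^ E s) h4).trans h3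
          rw [mul_add, mul_one] at h5
          have h6 : ((r ^ E s * R ^ 2 : ℕ) : ℤ) + (r ^ E s : ℕ) ≤
            (r ^ (center m p k s + prodM m (k + 1)) : ℕ) := by exact_mod_cast h5
          linarith
      refine (hdeg.absL_le hq).trans ?_
      have hH := heightP_le hq (natDegree_coeff_approxPoly_le (F := F) (r := r) (prodM m k) (E s) d)
      refine le_trans (le_of_eq ?_) (Real.rpow_le_rpow_of_nonpos (heightP_pos hq hP0) hH
        (by simp : -(R : ℝ) ^ 2 ≤ 0))
      rw [← Real.rpow_natCast, ← Real.rpow_mul (by positivity), ← Real.rpow_intCast]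
      congr 1
      push_cast
      ring

theorem wB_xi_eq_top [Fact p.Prime] [CharP F p] {q : ℕ} (hq : 1 < q) {a : ℕ} (ha : 0 < a)
    (hra : r = p ^ a) (hm0 : m 0 = 1) (hm : ∀ j, 1 ≤ j → 2 ≤ m j) :
    wB F q (xi F r m) = ⊤ := by
  have hr : 1 < r := hra ▸ Nat.one_lt_pow ha.ne' (Fact.out (p := p.Prime)).one_lt
  have hlt : ∀ k, k < r ^ prodM m k := fun k =>
    (lt_prodM hm0 hm k).trans (Nat.lt_pow_self hr)
  refine EReal.eq_top_iff_forall_lt _ |>.2 fun b => ?_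
  refine lt_of_lt_of_le (EReal.coe_lt_coe_iff.2 (lt_add_one b)) ?_
  refine Filter.le_limsup_of_frequently_le (Filter.frequently_atTop.2 fun N => ?_)
  obtain ⟨K, hK⟩ := exists_nat_ge (b + 1)
  set k := max N K
  have hk := hlt k
  refine ⟨r ^ prodM m k, (le_max_left N K).trans hk.le, ?_⟩
  set R := r ^ prodM m k with hR
  have hR0 : (0 : ℝ) < R := by exact_mod_cast (Nat.zero_le k).trans_lt hk
  have hbR : b + 1 ≤ R :=
    hK.trans (by exact_mod_cast (le_max_right N K).trans hk.le)
  refine le_trans ?_ (EReal.div_le_div_right_of_nonneg (by positivity)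
    (sq_le_wn_xi hq ha hra hm0 hm k))
  rw [← hR, ← EReal.coe_natCast, ← EReal.coe_div, EReal.coe_le_coe_iff, sq,
    mul_div_cancel_right₀ _ hR0.ne']
  exact hbR

end Lower

/-! ### Upper bounds for `w_n(ξ)` -/

section Upper

variable {F : Type} [Field F]

/-- All coefficients of `g` have degree at most `H` in `T`. -/
def CoeffDegLE (H : ℕ) (g : F[X][X]) : Prop := ∀ l, (g.coeff l).natDegree ≤ H

theorem coeffDegLE_C {H : ℕ} {a : F[X]} (ha : a.natDegree ≤ H) : CoeffDegLE H (C a) := fun l => by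
  rw [coeff_C]
  split_ifs
  · exact ha
  · simp

theorem CoeffDegLE.mul {H K : ℕ} {f g : F[X][X]} (hf : CoeffDegLE H f) (hg : CoeffDegLE K g) :
    CoeffDegLE (H + K) (f * g) := fun l => by
  rw [coeff_mul]
  exact natDegree_sum_le_of_forall_le _ _ fun x _ =>
    natDegree_mul_le.trans (add_le_add (hf _) (hg _))

theorem CoeffDegLE.pow {H : ℕ} {f : F[X][X]} (hf : CoeffDegLE H f) (j : ℕ) :
    CoeffDegLE (j * H) (f ^ j) := by
  induction j with
  | zero => simpa using coeffDegLE_C (a := (1 : F[X])) (by simp)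
  | succ j ih => simpa [pow_succ, Nat.succ_mul] using ih.mul hf

theorem CoeffDegLE.sum {ι : Type*} {s : Finset ι} {H : ℕ} {f : ι → F[X][X]}
    (hf : ∀ i ∈ s, CoeffDegLE H (f i)) : CoeffDegLE H (∑ i ∈ s, f i) := fun l => by
  rw [finsetSum_coeff]
  exact natDegree_sum_le_of_forall_le _ _ fun i hi => hf i hi l

theorem coeffDegLE_linear {H : ℕ} {u v : F[X]} (hu : u.natDegree ≤ H) (hv : v.natDegree ≤ H) :
    CoeffDegLE H (C u * X + C v) := fun l => by
  rw [coeff_add, coeff_C_mul, coeff_X, coeff_C]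
  refine (natDegree_add_le _ _).trans (max_le ?_ ?_)
  · split_ifs <;> simp [hu]
  · split_ifs <;> simp [hv]

/-- If `T^N θ = u α + v`, then `T^{nN} P(θ) = g(α)` with `g` of controlled size. -/
theorem exists_eval_eq_mul_evalP {α θ : LaurentSeries F} {u v : F[X]} {N n h : ℕ}
    (hu : u.natDegree ≤ N) (hv : v.natDegree ≤ N)
    (hθ : ringHomT F (X ^ N) * θ = ringHomT F u * α + ringHomT F v)
    {P : F[X][X]} (hPn : P.natDegree ≤ n) (hP : CoeffDegLE h P) :
    ∃ g : F[X][X], g.natDegree ≤ n ∧ CoeffDegLE (h + n * N) g ∧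
      g.eval₂ (ringHomT F) α = ringHomT F (X ^ (n * N)) * evalP F θ P := by
  refine ⟨∑ j ∈ Finset.range (n + 1), C (P.coeff j * X ^ ((n - j) * N)) * (C u * X + C v) ^ j,
    ?_, ?_, ?_⟩
  · refine natDegree_sum_le_of_forall_le _ _ fun j hj => ?_
    refine (natDegree_C_mul_le _ _).trans ((natDegree_pow_le_of_le j
      (natDegree_linear_le (a := u) (b := v))).trans ?_)
    rw [Finset.mem_range] at hj
    omega
  · refine CoeffDegLE.sum fun j hj => ?_
    rw [Finset.mem_range] at hj
    have hC : CoeffDegLE (h + (n - j) * N) (C (P.coeff j * X ^ ((n - j) * N))) :=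
      coeffDegLE_C (natDegree_mul_le.trans (add_le_add (hP j) (natDegree_X_pow _).le))
    have := hC.mul ((coeffDegLE_linear hu hv).pow j)
    rwa [add_assoc, ← add_mul, Nat.sub_add_cancel (by omega)] at this
  · rw [evalP, eval₂_eq_sum_range' _ (Nat.lt_succ_of_le hPn), eval₂_finsetSum, Finset.mul_sum]
    refine Finset.sum_congr rfl fun j hj => ?_
    rw [Finset.mem_range] at hj
    rw [eval₂_mul, eval₂_C, eval₂_pow, eval₂_add, eval₂_mul, eval₂_C, eval₂_C, eval₂_X, ← hθ,
      mul_pow, map_mul, ← map_pow (ringHomT F) (X ^ N) j]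
    have : (X : F[X]) ^ (n * N) = X ^ ((n - j) * N) * (X ^ N) ^ j := by
      rw [← pow_mul, ← pow_add, mul_comm N j, ← add_mul, Nat.sub_add_cancel (by omega)]
    rw [this, map_mul]
    ring

theorem degLE_evalP_sub {x y : LaurentSeries F} (hx : DegLE 0 x) (hy : DegLE 0 y) {k : ℤ}
    (hxy : DegLE k (x - y)) {P : F[X][X]} {h : ℕ} (hP : CoeffDegLE h P) :
    DegLE (h + k) (evalP F x P - evalP F y P) := by
  have hpow : ∀ j : ℕ, DegLE k (x ^ j - y ^ j) := by
    intro j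
    induction j with
    | zero => simpa using degLE_zero k
    | succ j ih =>
      rw [show x ^ (j + 1) - y ^ (j + 1) = x * (x ^ j - y ^ j) + (x - y) * y ^ j by ring]
      simpa using (hx.mul ih).add ((hxy.mul (hy.pow j)).mono (add_zero k |>.trans
        (zero_add k).symm).le)
  rw [evalP, evalP, eval₂_eq_sum_range, eval₂_eq_sum_range, ← Finset.sum_sub_distrib]
  refine DegLE.sum fun j _ => ?_
  rw [← mul_sub]
  exact (degLE_ringHomT (hP j)).mul (hpow j)

/-! #### The algebraic approximations -/

variable {m : ℕ → ℕ} {p r : ℕ}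

/-- The coefficients of `∑_{j > k} α_j`, truncated at the exponents `r^e` with `e ≤ E`. -/
def tailCoeff (m : ℕ → ℕ) (k E e : ℕ) : ℤ :=
  if e ≤ E then cntAll m e - cnt m (k + 1) e else 0

/-- The algebraic element `∑_{j ≤ k} α_j + δ` where `δ` is the truncation of `∑_{j > k} α_j`
at the exponents `r_{k+1}^i`. -/
def theta (F : Type) [Field F] (r : ℕ) (m : ℕ → ℕ) (k i : ℕ) : LaurentSeries F :=
  lac F r (cnt m (k + 1)) + lac F r (tailCoeff m k (prodM m (k + 1) * i))

theorem theta_eq_lac (hr : 1 < r) (k i : ℕ) : theta F r m k i =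
    lac F r (fun e => cnt m (k + 1) e + tailCoeff m k (prodM m (k + 1) * i) e) :=
  (lac_add hr _ _).symm

theorem degLE_zero_theta (hr : 1 < r) (k i : ℕ) : DegLE 0 (theta F r m k i) :=
  theta_eq_lac (F := F) hr k i ▸ degLE_zero_lac _

theorem degLE_xi_sub_theta (hr : 1 < r) (hm0 : m 0 = 1) (hm : ∀ j, 1 ≤ j → 2 ≤ m j) (k i : ℕ) :
    DegLE (-((r ^ prodM m (k + 1) * (r ^ prodM m (k + 1)) ^ i : ℕ) : ℤ))
      (xi F r m - theta F r m k i) := by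
  rw [xi_eq_lac hr hm0 hm, theta_eq_lac hr, ← lac_sub hr, ← pow_succ', ← pow_mul]
  refine degLE_lac hr fun e he1 he2 => ?_
  unfold tailCoeff
  split_ifs with h
  · simp
  · by_cases hd : prodM m (k + 1) ∣ e
    · obtain ⟨t, rfl⟩ := hd
      have h1 := lt_of_mul_lt_mul_left he2 (Nat.zero_le _)
      exact absurd (Nat.mul_le_mul_left _ (Nat.lt_succ_iff.1 h1)) h
    · rw [cntAll_eq_cnt hm0 hm he1 hd]
      simp

theorem theta_ne_theta (hr : 1 < r) (hm0 : m 0 = 1) (hm : ∀ j, 1 ≤ j → 2 ≤ m j) (k : ℕ)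
    {i j : ℕ} (hij : i + 2 ≤ j) : theta F r m k i ≠ theta F r m k j := by
  obtain ⟨t, hit, htj, ht⟩ : ∃ t, i < t ∧ t ≤ j ∧ ¬ m (k + 2) ∣ t := by
    have h2 := hm (k + 2) (by omega)
    by_cases h : m (k + 2) ∣ i + 1
    · refine ⟨i + 2, by omega, by omega, fun h' => ?_⟩
      have := Nat.le_of_dvd one_pos ((Nat.dvd_add_right h).1 h')
      omega
    · exact ⟨i + 1, by omega, by omega, h⟩
  have hpos := lt_prodM hm0 hm (k + 1)
  have he : 1 ≤ prodM m (k + 1) * t := Nat.mul_pos (by omega) (by omega)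
  intro h
  rw [theta, theta, add_right_inj] at h
  have hc := congrArg (fun f => HahnSeries.coeff f ((r ^ (prodM m (k + 1) * t) : ℕ) : ℤ)) h
  simp only [coeff_lac_pow hr _ he] at hc
  rw [tailCoeff, tailCoeff,
    if_neg (by rw [not_le]; exact Nat.mul_lt_mul_of_pos_left hit (by omega)),
    if_pos (Nat.mul_le_mul_left _ htj), cnt_of_dvd ((prodM_dvd (by omega)).trans (Dvd.intro _ rfl)),
    cntAll_of_dvd hm0 hm (k := k + 1) he (Dvd.intro _ rfl)] at hc
  · push_cast at hc
    simp at hc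
  · rw [prodM_succ, Nat.mul_dvd_mul_iff_left (by omega)]
    exact ht

theorem exists_evalP_theta_ne_zero (hr : 1 < r) (hm0 : m 0 = 1) (hm : ∀ j, 1 ≤ j → 2 ≤ m j)
    (k i : ℕ) {n : ℕ} {P : F[X][X]} (hP0 : P ≠ 0) (hPn : P.natDegree ≤ n) :
    ∃ l ≤ n, evalP F (theta F r m k (i + 2 * l)) P ≠ 0 := by
  by_contra! hall
  refine hP0 ((Polynomial.map_eq_zero_iff (ringHomT_injective (F := F))).1 ?_)
  refine Polynomial.eq_zero_of_natDegree_lt_card_of_eval_eq_zero _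
    (f := fun l : Fin (n + 1) => theta F r m k (i + 2 * l)) ?_ (fun l => ?_) ?_
  · intro l l' hll
    by_contra hne
    rcases lt_or_gt_of_ne hne with hlt | hlt
    · exact theta_ne_theta hr hm0 hm k (by omega) hll
    · exact theta_ne_theta hr hm0 hm k (by omega) hll.symm
  · rw [eval_map]
    exact hall l (by omega)
  · rw [Fintype.card_fin]
    exact lt_of_le_of_lt natDegree_map_le (by omega)

theorem exists_monic_eval_eq_zero [hp : Fact p.Prime] [CharP F p] {a : ℕ} (ha : 0 < a)
    (hra : r = p ^ a) (hm0 : m 0 = 1) (hm : ∀ j, 1 ≤ j → 2 ≤ m j) (k : ℕ) :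
    ∃ Q : F[X][X], Q.Monic ∧ Q.natDegree = r ^ prodM m k ∧
      Q.eval₂ (ringHomT F) (ringHomT F X * lac F r (cnt m (k + 1))) = 0 := by
  have hr : 1 < r := hra ▸ Nat.one_lt_pow ha.ne' hp.out.one_lt
  have hM := lt_prodM hm0 hm k
  set R := r ^ prodM m k with hR
  have hR1 : 1 < R := hR ▸ Nat.one_lt_pow (by omega) hr
  let d : ℕ → ℤ := fun e =>
    (if prodM m k < e then cnt m (k + 1) (e - prodM m k) else 0) - cnt m (k + 1) e
  have hlac : lac F r (cnt m (k + 1)) ^ R - lac F r (cnt m (k + 1)) =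
      lac F r (fun e => if e ≤ prodM m k then d e else 0) := by
    rw [hR, lac_pow ha hra, ← lac_sub hr]
    refine lac_congr hr fun e _ => ?_
    split_ifs with h1 h2 h2
    · omega
    · rw [← cnt_add_prodM k (e - prodM m k), Nat.sub_add_cancel h1.le, sub_self]
    · simp only [d, if_neg h1]
    · omega
  have hlow : (C (X ^ (R - 1)) * X + C (lacNum F r d (prodM m k)) : F[X][X]).degree < R :=
    lt_of_le_of_lt degree_linear_le (by exact_mod_cast hR1)
  refine ⟨X ^ R - (C (X ^ (R - 1)) * X + C (lacNum F r d (prodM m k))),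
    monic_X_pow_sub hlow, ?_, ?_⟩
  · exact natDegree_eq_of_degree_eq_some (by
      rw [degree_sub_eq_left_of_degree_lt (by rwa [degree_X_pow]), degree_X_pow])
  · rw [eval₂_sub, eval₂_add, eval₂_mul, eval₂_X_pow, eval₂_C, eval₂_C, eval₂_X,
      ringHomT_lacNum hr, ← hlac, ← hR, mul_pow, map_pow, map_pow]
    have : ringHomT F X ^ R = ringHomT F X ^ (R - 1) * ringHomT F X := by
      rw [← pow_succ, Nat.sub_add_cancel hR1.le]
    rw [this]
    ring

theorem exists_pow_between {S : ℕ} (hS : 1 < S) (x : ℕ) : ∃ i, x ≤ S ^ i ∧ S ^ i ≤ S * (x + 1) :=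
  ⟨Nat.log S (x + 1) + 1,
    (Nat.le_succ x).trans (Nat.lt_pow_succ_log_self hS _).le, by
      rw [pow_succ']
      exact Nat.mul_le_mul_left _ (Nat.pow_log_le_self S (by omega))⟩

theorem clearing_exponent_le {R h n N c K : ℕ} (hh : 1 ≤ h) (hN : N ≤ K * h) :
    R * (h + n * N) + c + n * N ≤ (R + (R + 1) * n * K + c) * h :=
  calc R * (h + n * N) + c + n * N = R * h + (R + 1) * n * N + c := by ring
    _ ≤ R * h + (R + 1) * n * (K * h) + c * h :=
      Nat.add_le_add (Nat.add_le_add_left (Nat.mul_le_mul_left _ hN) _)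
        (Nat.le_mul_of_pos_right _ hh)
    _ = _ := by ring

theorem clearing_exponent_add_le {R h n N c S : ℕ} (hS : (R + 1) * n + 1 ≤ S)
    (hN : (R + 1) * h + c ≤ N) : R * (h + n * N) + c + n * N + h ≤ S * N :=
  calc R * (h + n * N) + c + n * N + h = (R + 1) * n * N + ((R + 1) * h + c) := by ring
    _ ≤ (R + 1) * n * N + N := Nat.add_le_add_left hN _
    _ = ((R + 1) * n + 1) * N := by ring
    _ ≤ S * N := Nat.mul_le_mul_right N hS

theorem exists_not_degLE_evalP_xi [hp : Fact p.Prime] [CharP F p] {a : ℕ} (ha : 0 < a)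
    (hra : r = p ^ a) (hm0 : m 0 = 1) (hm : ∀ j, 1 ≤ j → 2 ≤ m j) (n : ℕ) :
    ∃ W : ℕ, ∀ (P : F[X][X]) (h : ℕ), P ≠ 0 → P.natDegree ≤ n → 1 ≤ h → CoeffDegLE h P →
      ¬ DegLE (-((W * h : ℕ) : ℤ)) (evalP F (xi F r m) P) := by
  have hr : 1 < r := hra ▸ Nat.one_lt_pow ha.ne' hp.out.one_lt
  set k := n + 1 with hk
  obtain ⟨Q, hQ, hQR, hQ0⟩ := exists_monic_eval_eq_zero (F := F) ha hra hm0 hm k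
  obtain ⟨c, hc⟩ := liouville_ringHomT hQ hQ0 n
  rw [hQR] at hc
  set R := r ^ prodM m k with hR
  set S := r ^ prodM m (k + 1) with hS
  have hMk := lt_prodM hm0 hm k
  have hRn : n + 2 ≤ R := by
    have := Nat.lt_pow_self hr (n := prodM m k)
    omega
  have hRS : R ^ 2 ≤ S := by
    rw [hR, ← pow_mul, hS]
    exact Nat.pow_le_pow_right (by omega) (by have := two_mul_prodM_le hm k; omega)
  have hS1 : 1 < S := by nlinarith
  have hSn : (R + 1) * n + 1 ≤ S := by nlinarith
  refine ⟨R + (R + 1) * n * (S ^ (2 * n) * (S * (R + 1 + c + 1))) + c, ?_⟩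
  intro P h hP0 hPn hh hP hdeg
  obtain ⟨i, hi1, hi2⟩ := exists_pow_between hS1 ((R + 1) * h + c)
  obtain ⟨l, hl, hne⟩ := exists_evalP_theta_ne_zero hr hm0 hm k i hP0 hPn
  set θ := theta F r m k (i + 2 * l) with hθ
  set N := S ^ (i + 2 * l) with hN
  have hN1 : 1 ≤ N := Nat.one_le_pow _ _ (by omega)
  have hNl : (R + 1) * h + c ≤ N := hi1.trans (Nat.pow_le_pow_right (by omega) (by omega))
  have hNu : N ≤ S ^ (2 * n) * (S * (R + 1 + c + 1)) * h := by
    have h1 : S * ((R + 1) * h + c + 1) ≤ S * (R + 1 + c + 1) * h := by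
      rw [mul_assoc]
      exact Nat.mul_le_mul_left _ (by nlinarith)
    calc N = S ^ (2 * l) * S ^ i := by rw [hN, ← pow_add, add_comm]
      _ ≤ S ^ (2 * n) * (S * (R + 1 + c + 1) * h) :=
        Nat.mul_le_mul (Nat.pow_le_pow_right (by omega) (by omega)) (hi2.trans h1)
      _ = _ := by ring
  -- the cleared value of `P` at `θ`
  obtain ⟨g, hgn, hgH, hg⟩ := exists_eval_eq_mul_evalP (F := F)
    (α := ringHomT F X * lac F r (cnt m (k + 1))) (θ := θ) (u := X ^ (N - 1))
    (v := lacNum F r (fun e => cntAll m e - cnt m (k + 1) e) (prodM m (k + 1) * (i + 2 * l)))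
    (N := N) ((natDegree_X_pow _).le.trans (Nat.sub_le _ _))
    ((natDegree_lacNum_le _ _).trans (by rw [hN, hS, ← pow_mul])) (by
      rw [ringHomT_lacNum hr, pow_mul, ← hS, ← hN, ← mul_assoc, ← map_mul, ← pow_succ,
        Nat.sub_add_cancel hN1, ← mul_add]
      rfl) hPn hP
  have hg0 : g.eval₂ (ringHomT F) (ringHomT F X * lac F r (cnt m (k + 1))) ≠ 0 := by
    rw [hg]
    exact mul_ne_zero
      ((map_ne_zero_iff _ ringHomT_injective).2 (pow_ne_zero _ X_ne_zero)) hne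
  refine hc _ g hgn hgH hg0 ?_
  have hsub := degLE_evalP_sub
    (by rw [xi_eq_lac hr hm0 hm]; exact degLE_zero_lac _ : DegLE 0 (xi F r m))
    (degLE_zero_theta hr k (i + 2 * l)) (degLE_xi_sub_theta hr hm0 hm k (i + 2 * l)) hP
  rw [← hS, ← hN] at hsub
  have hbound : (R * (h + n * N) + c) + n * N ≤
      (R + (R + 1) * n * (S ^ (2 * n) * (S * (R + 1 + c + 1))) + c) * h :=
    clearing_exponent_le hh hNu
  have hgap : (R * (h + n * N) + c) + n * N + h ≤ S * N :=
    clearing_exponent_add_le hSn hNl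
  have hPθ : DegLE (-((R * (h + n * N) + c + n * N : ℕ) : ℤ)) (evalP F θ P) := by
    rw [show evalP F θ P = evalP F (xi F r m) P - (evalP F (xi F r m) P - evalP F θ P) by ring]
    refine (hdeg.mono ?_).sub (hsub.mono ?_)
    · exact neg_le_neg (by exact_mod_cast hbound)
    · have : (((R * (h + n * N) + c) + n * N + h : ℕ) : ℤ) ≤ (S * N : ℕ) := by exact_mod_cast hgap
      push_cast at this ⊢
      linarith
  rw [hg]
  refine ((degLE_ringHomT (natDegree_X_pow _).le).mul hPθ).mono (le_of_eq ?_)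
  push_cast
  ring

theorem finite_setOf_coeffDegLE_zero [Finite F] (n : ℕ) :
    {P : F[X][X] | P.natDegree ≤ n ∧ CoeffDegLE 0 P}.Finite := by
  refine Set.Finite.of_injOn (f := fun (P : F[X][X]) (l : Fin (n + 1)) => (P.coeff l).coeff 0)
    (t := Set.univ) (fun _ _ => Set.mem_univ _) ?_ Set.finite_univ
  intro P hP P' hP' heq
  ext1 l
  by_cases hl : l ≤ n
  · have := congrFun heq ⟨l, Nat.lt_succ_of_le hl⟩
    simp only at this
    rw [eq_C_of_natDegree_le_zero (hP.2 l), eq_C_of_natDegree_le_zero (hP'.2 l), this]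
  · rw [coeff_eq_zero_of_natDegree_lt (hP.1.trans_lt (not_le.1 hl)),
      coeff_eq_zero_of_natDegree_lt (hP'.1.trans_lt (not_le.1 hl))]

theorem wn_xi_lt_top [Finite F] [Fact p.Prime] [CharP F p] {q : ℕ} (hq : 1 < q) {a : ℕ}
    (ha : 0 < a) (hra : r = p ^ a) (hm0 : m 0 = 1) (hm : ∀ j, 1 ≤ j → 2 ≤ m j) (n : ℕ) :
    wn F q n (xi F r m) < ⊤ := by
  obtain ⟨W, hW⟩ := exists_not_degLE_evalP_xi (F := F) ha hra hm0 hm n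
  refine lt_of_le_of_lt (sSup_le ?_) (EReal.coe_lt_top (W : ℝ))
  rintro _ ⟨w, hw, rfl⟩
  refine EReal.coe_le_coe_iff.2 (not_lt.1 fun hlt => hw ?_)
  refine (finite_setOf_coeffDegLE_zero n).subset ?_
  rintro P ⟨hPn, hpos, hle⟩
  refine ⟨hPn, ?_⟩
  have hP0 : P ≠ 0 := by
    rintro rfl
    simp [evalP, absL] at hpos
  rw [heightP, if_neg hP0] at hle
  set h := P.support.sup fun i => (P.coeff i).natDegree with hh
  have hPh : CoeffDegLE h P := fun l => by
    by_cases hl : l ∈ P.support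
    · exact Finset.le_sup (f := fun i => (P.coeff i).natDegree) hl
    · simp [notMem_support_iff.1 hl]
  rcases Nat.eq_zero_or_pos h with h0 | h0
  · rwa [h0] at hPh
  · refine absurd (degLE_of_absL_le hq (hle.trans ?_)) (hW P h hP0 hPn h0 hPh)
    have hq1 : (1 : ℝ) < q := by exact_mod_cast hq
    rw [← Real.rpow_natCast, ← Real.rpow_mul (by positivity), ← Real.rpow_intCast,
      Real.rpow_le_rpow_left_iff hq1]
    push_cast
    have : (0 : ℝ) < h := by exact_mod_cast h0
    nlinarith

end Upper

end OotoT

/-- For `r` a power of `p` and `m = (m_j)` with `m_0 = 1`, `m_j ≥ 2` for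
`j ≥ 1`, the Laurent series `ξ(r, m)` is a `T`-number. -/
theorem xi_isTNumber (p : ℕ) (hp : p.Prime) (q : ℕ) (hq : ∃ e : ℕ, 0 < e ∧ q = p ^ e)
    (Fq : Type) [Field Fq] [Fintype Fq] [CharP Fq p] (hcard : Fintype.card Fq = q)
    (r : ℕ) (hr : ∃ e : ℕ, 0 < e ∧ r = p ^ e)
    (m : ℕ → ℕ) (hm0 : m 0 = 1) (hm : ∀ j : ℕ, 1 ≤ j → 2 ≤ m j) :
    IsTNumber Fq q (xi Fq r m) := by
  obtain ⟨f, hf, rfl⟩ := hq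
  obtain ⟨a, ha, hra⟩ := hr
  have : Fact p.Prime := ⟨hp⟩
  have hq1 : 1 < p ^ f := Nat.one_lt_pow hf.ne' hp.one_lt
  exact ⟨wB_xi_eq_top hq1 ha hra hm0 hm, fun n _ => wn_xi_lt_top hq1 ha hra hm0 hm n⟩
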